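/- There exist absolute constants ε₀ > 0 and C > 0 such that for every (1+ε)-quasigeodesic γ : ℝ → ℍ with ε < ε₀ and for all s₀, s ∈ ℝ, writing γ(s₀)⁻¹·γ(s) = (z;t), one has |t| ≤ C ε^{1/4} |z|²; that is, γ never intersects the left translate by γ(s₀) of the dilation-invariant set {(z;t) ∈ ℍ : |t| > C ε^{1/4} |z|²}. -/

import Mathlib

noncomputable section

open MeasureTheory

/-- Points of the Heisenberg group `ℍ`, identified with `ℝ³ ≅ ℂ × ℝ`:
`(x, y, t)` corresponds to `(z ; t)` with `z = x + iy`. -/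
abbrev H : Type := ℝ × ℝ × ℝ

/-- The Heisenberg group law
`(x,y,t)·(x',y',t') = (x+x', y+y', t+t'+2(x'y − xy'))`. -/
def Hmul (p q : H) : H :=
  (p.1 + q.1, p.2.1 + q.2.1, p.2.2 + q.2.2 + 2 * (q.1 * p.2.1 - p.1 * q.2.1))

/-- The Heisenberg group inverse. -/
def Hinv (p : H) : H := (-p.1, -p.2.1, -p.2.2)

/-- The identity `O = (0,0,0)`. -/
def HO : H := (0, 0, 0)

/-- The control (Carnot–Carathéodory) distance: the infimum of the lengths
`∫₀¹ √(a(s)² + b(s)²) ds` of horizontal Lipschitz curves `γ` joining `P` to `Q`,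
i.e. curves satisfying a.e. `γ' = a·X(γ) + b·Y(γ)` where `X = ∂ₓ + 2y∂_t` and
`Y = ∂_y − 2x∂_t`. -/
def dH (P Q : H) : ℝ :=
  sInf { L : ℝ | ∃ (γ : ℝ → H) (a b : ℝ → ℝ) (K : NNReal),
    LipschitzWith K γ ∧ γ 0 = P ∧ γ 1 = Q ∧
    (∀ᵐ s ∂volume, s ∈ Set.Icc (0:ℝ) 1 →
      HasDerivAt γ (a s, b s, 2 * (γ s).2.1 * a s - 2 * (γ s).1 * b s) s) ∧
    IntervalIntegrable (fun s => Real.sqrt (a s ^ 2 + b s ^ 2)) volume 0 1 ∧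
    L = ∫ s in (0:ℝ)..1, Real.sqrt (a s ^ 2 + b s ^ 2) }

/-- `γ : ℝ → ℍ` is a `(1+ε)`-quasigeodesic. -/
def IsQuasiGeodesic (ε : ℝ) (γ : ℝ → H) : Prop :=
  ∀ s s' : ℝ, (1 + ε)⁻¹ * |s - s'| ≤ dH (γ s) (γ s') ∧
    dH (γ s) (γ s') ≤ (1 + ε) * |s - s'|

/-- `f : ℍ → ℍ` is `(1+ε)`-biLipschitz for the control distance. -/
def IsBiLip (ε : ℝ) (f : H → H) : Prop :=
  ∀ P Q : H, (1 + ε)⁻¹ * dH P Q ≤ dH (f P) (f Q) ∧ dH (f P) (f Q) ≤ (1 + ε) * dH P Q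

/-- `(a,b)` is the horizontal speed of `γ`: a.e. `γ'(s) = a(s)X(γ(s)) + b(s)Y(γ(s))`. -/
def HasHorizSpeed (γ : ℝ → H) (a b : ℝ → ℝ) : Prop :=
  ∀ᵐ s ∂volume, HasDerivAt γ (a s, b s, 2 * (γ s).2.1 * a s - 2 * (γ s).1 * b s) s

def lenSet (P Q : H) : Set ℝ := { L : ℝ | ∃ (γ : ℝ → H) (a b : ℝ → ℝ) (K : NNReal),
    LipschitzWith K γ ∧ γ 0 = P ∧ γ 1 = Q ∧
    (∀ᵐ s ∂volume, s ∈ Set.Icc (0:ℝ) 1 →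
      HasDerivAt γ (a s, b s, 2 * (γ s).2.1 * a s - 2 * (γ s).1 * b s) s) ∧
    IntervalIntegrable (fun s => Real.sqrt (a s ^ 2 + b s ^ 2)) volume 0 1 ∧
    L = ∫ s in (0:ℝ)..1, Real.sqrt (a s ^ 2 + b s ^ 2) }

lemma dH_eq (P Q : H) : dH P Q = sInf (lenSet P Q) := rfl

lemma lenSet_nonneg {P Q : H} {L : ℝ} (h : L ∈ lenSet P Q) : 0 ≤ L := by
  obtain ⟨γ, a, b, K, -, -, -, -, -, rfl⟩ := h
  exact intervalIntegral.integral_nonneg zero_le_one fun s _ => Real.sqrt_nonneg _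

lemma dH_le {P Q : H} {L : ℝ} (h : L ∈ lenSet P Q) : dH P Q ≤ L :=
  csInf_le ⟨0, fun _ hx => lenSet_nonneg hx⟩ h

/-- squared horizontal displacement -/
def rA (P Q : H) : ℝ := (Hmul (Hinv P) Q).1 ^ 2 + (Hmul (Hinv P) Q).2.1 ^ 2
/-- vertical displacement -/
def rT (P Q : H) : ℝ := (Hmul (Hinv P) Q).2.2

lemma rA_eq (P Q : H) : rA P Q = (Q.1 - P.1) ^ 2 + (Q.2.1 - P.2.1) ^ 2 := by
  simp only [rA, Hmul, Hinv]; ring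

lemma rT_eq (P Q : H) : rT P Q = Q.2.2 - P.2.2 + 2 * (P.1 * Q.2.1 - Q.1 * P.2.1) := by
  simp only [rT, Hmul, Hinv]; ring

lemma ac_comp {f g : ℝ → ℝ} {a b : ℝ} {K : NNReal} {S : Set ℝ}
    (hf : AbsolutelyContinuousOnInterval f a b)
    (hg : LipschitzOnWith K g S) (hS : ∀ x ∈ Set.uIcc a b, f x ∈ S) :
    AbsolutelyContinuousOnInterval (fun x => g (f x)) a b := by
  rw [absolutelyContinuousOnInterval_iff] at hf ⊢
  intro ε hε
  obtain ⟨δ, hδ, h⟩ := hf (ε / (K + 1)) (by positivity)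
  refine ⟨δ, hδ, fun E hE hE2 => ?_⟩
  have h1 := h E hE hE2
  have hE' := hE
  simp only [AbsolutelyContinuousOnInterval.disjWithin] at hE'
  have : ∑ i ∈ Finset.range E.1, dist (g (f (E.2 i).1)) (g (f (E.2 i).2)) ≤
      ∑ i ∈ Finset.range E.1, K * dist (f (E.2 i).1) (f (E.2 i).2) := by
    apply Finset.sum_le_sum
    intro i hi
    have := hE'.1 i hi
    exact hg.dist_le_mul _ (hS _ this.1) _ (hS _ this.2)
  rw [← Finset.mul_sum] at this
  calc _ ≤ _ := this
    _ ≤ (K + 1) * ∑ i ∈ Finset.range E.1, dist (f (E.2 i).1) (f (E.2 i).2) := by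
      apply mul_le_mul_of_nonneg_right (by linarith)
      exact Finset.sum_nonneg fun i _ => dist_nonneg
    _ < (K + 1) * (ε / (K + 1)) := by gcongr
    _ = ε := by field_simp

lemma key_ineq (κ C S ς a b u v m : ℝ) (hκ : 0 < κ) (hS : 0 < S) (hCS : S ^ 2 + C ^ 2 = 1)
    (hς : ς ^ 2 = 1) (hm : m = Real.sqrt (a ^ 2 + b ^ 2)) :
    κ * ((-κ / S ^ 2 * m) * (u ^ 2 + v ^ 2) + C / S * (2 * u * a + 2 * v * b))
      + κ * ς * (2 * v * a - 2 * u * b) ≤ m := by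
  have hm0 : 0 ≤ m := hm ▸ Real.sqrt_nonneg _
  have hm2 : m ^ 2 = a ^ 2 + b ^ 2 := by rw [hm, Real.sq_sqrt (by positivity)]
  set ρ := Real.sqrt (u ^ 2 + v ^ 2) with hρ
  have hρ0 : 0 ≤ ρ := Real.sqrt_nonneg _
  have hρ2 : ρ ^ 2 = u ^ 2 + v ^ 2 := by rw [hρ, Real.sq_sqrt (by positivity)]
  have hX : C * (u * a + v * b) + ς * S * (v * a - u * b) ≤ ρ * m := by
    apply abs_le_of_sq_le_sq' _ (by positivity) |>.2
    have e : (ρ * m) ^ 2 = (u ^ 2 + v ^ 2) * (a ^ 2 + b ^ 2) := by rw [mul_pow, hρ2, hm2]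
    rw [e]
    have : (C * (u * a + v * b) + ς * S * (v * a - u * b)) ^ 2 +
      (C * (v * a - u * b) - ς * S * (u * a + v * b)) ^ 2 = (u ^ 2 + v ^ 2) * (a ^ 2 + b ^ 2) := by
      have : (C * (u * a + v * b) + ς * S * (v * a - u * b)) ^ 2 +
        (C * (v * a - u * b) - ς * S * (u * a + v * b)) ^ 2
        = (C ^ 2 + ς ^ 2 * S ^ 2) * ((u ^ 2 + v ^ 2) * (a ^ 2 + b ^ 2)) := by ring
      rw [this, hς, one_mul, add_comm, hCS, one_mul]
    nlinarith [sq_nonneg (C * (v * a - u * b) - ς * S * (u * a + v * b))]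
  have h2 : κ * ((-κ / S ^ 2 * m) * (u ^ 2 + v ^ 2) + C / S * (2 * u * a + 2 * v * b))
      + κ * ς * (2 * v * a - 2 * u * b) =
      (2 * κ * S * (C * (u * a + v * b) + ς * S * (v * a - u * b)) - κ ^ 2 * ρ ^ 2 * m) / S ^ 2 := by
    rw [hρ2]; field_simp; ring
  rw [h2, div_le_iff₀ (by positivity)]
  have h3 : 2 * κ * S * (C * (u * a + v * b) + ς * S * (v * a - u * b)) ≤ 2 * κ * S * (ρ * m) :=
    mul_le_mul_of_nonneg_left hX (by positivity)
  nlinarith [mul_nonneg hm0 (sq_nonneg (κ * ρ - S))]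

lemma lower_len {P Q : H} {L Λ θ ς : ℝ} (hL : L ∈ lenSet P Q) (hΛ : L < Λ) (h0 : 0 < θ)
    (hπ : θ < Real.pi) (hς : ς ^ 2 = 1) :
    θ * (Real.cos θ / Real.sin θ) * rA P Q + θ * ς * rT P Q ≤ Λ ^ 2 := by
  have hL0 := lenSet_nonneg hL
  obtain ⟨γ, a, b, K, hlip, hg0, hg1, hder, hint, hLe⟩ := hL
  have hΛ0 : 0 < Λ := by linarith
  set κ := θ / Λ with hκ
  have hκ0 : 0 < κ := by positivity
  have hκΛ : κ * Λ = θ := by rw [hκ]; field_simp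
  set δ := Λ - L with hδ
  have hδ0 : 0 < δ := by linarith
  set m : ℝ → ℝ := fun s => Real.sqrt (a s ^ 2 + b s ^ 2) with hm
  set I : ℝ → ℝ := fun s => ∫ r in (0:ℝ)..s, m r with hI
  set g : ℝ → ℝ := fun r => Real.cos (κ * (δ + r)) / Real.sin (κ * (δ + r)) with hg
  have hS : ∀ r ∈ Set.Icc 0 L, 0 < Real.sin (κ * (δ + r)) := by
    intro r hr
    apply Real.sin_pos_of_pos_of_lt_pi
    · have := hr.1; positivity
    · calc κ * (δ + r) ≤ κ * Λ := by gcongr; linarith [hr.2]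
        _ < Real.pi := by rw [hκΛ]; exact hπ
  have hgd : ∀ r ∈ Set.Icc 0 L, HasDerivAt g (-κ / Real.sin (κ * (δ + r)) ^ 2) r := by
    intro r hr
    have h1 : HasDerivAt (fun r => κ * (δ + r)) κ r := by
      simpa using ((hasDerivAt_id r).const_add δ).const_mul κ
    have := h1.cos.div h1.sin (hS r hr).ne'
    convert! this using 1
    have e := Real.sin_sq_add_cos_sq (κ * (δ + r))
    congr 1
    linear_combination (-κ) * (-e)
  have hmint : ∀ s ∈ Set.Icc (0:ℝ) 1, I s ∈ Set.Icc 0 L := by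
    intro s hs
    constructor
    · exact intervalIntegral.integral_nonneg hs.1 fun s _ => Real.sqrt_nonneg _
    · rw [hLe]
      apply intervalIntegral.integral_mono_interval le_rfl hs.1 hs.2 _ hint
      exact Filter.Eventually.of_forall fun s => Real.sqrt_nonneg _
  have hgl : ∃ K, LipschitzOnWith K g (Set.Icc 0 L) := by
    apply ContDiffOn.exists_lipschitzOnWith (n := 1) _ (by decide) (convex_Icc _ _) isCompact_Icc
    apply ContDiffOn.div
    · fun_prop
    · fun_prop
    · intro r hr; exact (hS r hr).ne'
  obtain ⟨Kg, hKg⟩ := hgl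
  have u01 : Set.uIcc (0:ℝ) 1 = Set.Icc 0 1 := Set.uIcc_of_le zero_le_one
  have acI : AbsolutelyContinuousOnInterval I 0 1 :=
    hint.absolutelyContinuousOnInterval_intervalIntegral (by simp)
  have acg : AbsolutelyContinuousOnInterval (fun s => g (I s)) 0 1 :=
    ac_comp acI hKg (by rw [u01]; exact hmint)
  have lx : LipschitzWith K (fun s => (γ s).1) := by
    simpa using! (LipschitzWith.prod_fst).comp hlip
  have lyt : LipschitzWith K (fun s => (γ s).2) := by
    simpa using! (LipschitzWith.prod_snd).comp hlip
  have ly : LipschitzWith K (fun s => (γ s).2.1) := by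
    simpa using! (LipschitzWith.prod_fst).comp lyt
  have lt : LipschitzWith K (fun s => (γ s).2.2) := by
    simpa using! (LipschitzWith.prod_snd).comp lyt
  have acx := (lx.lipschitzOnWith (s := Set.uIcc 0 1)).absolutelyContinuousOnInterval
  have acy := (ly.lipschitzOnWith (s := Set.uIcc 0 1)).absolutelyContinuousOnInterval
  have act := (lt.lipschitzOnWith (s := Set.uIcc 0 1)).absolutelyContinuousOnInterval
  have acc : ∀ c : ℝ, AbsolutelyContinuousOnInterval (fun _ : ℝ => c) 0 1 := fun c =>
    ((LipschitzWith.const c).lipschitzOnWith (s := Set.uIcc 0 1)).absolutelyContinuousOnInterval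
  set F : ℝ → ℝ := fun s => κ * (g (I s) * (((γ s).1 - P.1) ^ 2 + ((γ s).2.1 - P.2.1) ^ 2))
    + κ * ς * ((γ s).2.2 - P.2.2 + 2 * (P.1 * (γ s).2.1 - (γ s).1 * P.2.1)) with hF
  have acF : AbsolutelyContinuousOnInterval F 0 1 := by
    have ax := acx.sub (acc P.1)
    have ay := acy.sub (acc P.2.1)
    have at' := act.sub (acc P.2.2)
    have h1 := (acg.mul ((ax.mul ax).add (ay.mul ay))).const_mul κ
    have h2 := (at'.add (((acy.const_mul P.1).sub (acx.const_mul P.2.1)).const_mul 2)).const_mul (κ * ς)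
    convert! h1.add h2 using 1
    ext s
    simp only [hF, Pi.add_apply, Pi.mul_apply, Pi.sub_apply]
    ring
  have hFd : ∀ᵐ s, s ∈ Set.Icc (0:ℝ) 1 → deriv F s ≤ m s := by
    filter_upwards [hder, hint.ae_hasDerivAt_integral] with s h1 h2 hs
    have hd := h1 hs
    have hId : HasDerivAt I (m s) s := h2 (by rwa [u01]) 0 (by simp)
    have dx : HasDerivAt (fun s => (γ s).1) (a s) s := by
      simpa using! (hasFDerivAt_fst (𝕜 := ℝ) (p := γ s)).comp_hasDerivAt s hd
    have dyt : HasDerivAt (fun s => (γ s).2) (b s, 2 * (γ s).2.1 * a s - 2 * (γ s).1 * b s) s := by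
      simpa using! (hasFDerivAt_snd (𝕜 := ℝ) (p := γ s)).comp_hasDerivAt s hd
    have dy : HasDerivAt (fun s => (γ s).2.1) (b s) s := by
      simpa using! (hasFDerivAt_fst (𝕜 := ℝ) (p := (γ s).2)).comp_hasDerivAt s dyt
    have dt : HasDerivAt (fun s => (γ s).2.2) (2 * (γ s).2.1 * a s - 2 * (γ s).1 * b s) s := by
      simpa using! (hasFDerivAt_snd (𝕜 := ℝ) (p := (γ s).2)).comp_hasDerivAt s dyt
    have dg : HasDerivAt (fun s => g (I s)) (-κ / Real.sin (κ * (δ + I s)) ^ 2 * m s) s :=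
      HasDerivAt.comp s (hgd _ (hmint s hs)) hId
    have dF := ((dg.fun_mul (((dx.sub_const P.1).fun_pow 2).fun_add ((dy.sub_const P.2.1).fun_pow 2))).const_mul κ).fun_add
      (((dt.sub_const P.2.2).fun_add (((dy.const_mul P.1).fun_sub (dx.mul_const P.2.1)).const_mul 2)).const_mul (κ * ς))
    have dF' : deriv F s = _ := dF.deriv
    rw [dF']
    have := key_ineq κ (Real.cos (κ * (δ + I s))) (Real.sin (κ * (δ + I s))) ς (a s) (b s)
      ((γ s).1 - P.1) ((γ s).2.1 - P.2.1) (m s) hκ0 (hS _ (hmint s hs))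
      (Real.sin_sq_add_cos_sq _) hς rfl
    refine le_trans (le_of_eq ?_) this
    simp only [hg]
    push_cast
    ring
  have h1 : F 1 - F 0 ≤ L := by
    rw [← acF.integral_deriv_eq_sub, hLe]
    apply intervalIntegral.integral_mono_ae_restrict zero_le_one acF.intervalIntegrable_deriv hint
    exact (ae_restrict_iff' measurableSet_Icc).2 hFd
  have hI1 : I 1 = L := hLe.symm
  have hF0 : F 0 = 0 := by
    simp only [hF, hg0]; ring
  have hF1 : F 1 = κ * (Real.cos θ / Real.sin θ) * rA P Q + κ * ς * rT P Q := by
    simp only [hF, hg1, hI1, rA_eq, rT_eq, hg]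
    rw [show κ * (δ + L) = θ by rw [← hκΛ, hδ]; ring]
    ring
  rw [hF0, hF1] at h1
  have : Λ * (κ * (Real.cos θ / Real.sin θ) * rA P Q + κ * ς * rT P Q) ≤ Λ * Λ := by
    apply mul_le_mul_of_nonneg_left _ hΛ0.le; linarith
  calc _ = Λ * (κ * (Real.cos θ / Real.sin θ) * rA P Q + κ * ς * rT P Q) := by
        rw [← hκΛ]; ring
    _ ≤ Λ * Λ := this
    _ = Λ ^ 2 := by ring

lemma smooth_len {P Q : H} {x y t a b : ℝ → ℝ} {l : ℝ} (hx : ContDiff ℝ 1 x) (hy : ContDiff ℝ 1 y)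
    (ht : ContDiff ℝ 1 t) (dx : ∀ s, HasDerivAt x (a s) s) (dy : ∀ s, HasDerivAt y (b s) s)
    (dt : ∀ s, HasDerivAt t (2 * y s * a s - 2 * x s * b s) s)
    (h0 : (x 0, y 0, t 0) = P) (h1 : (x 1, y 1, t 1) = Q) (hl : 0 ≤ l)
    (hab : ∀ s, a s ^ 2 + b s ^ 2 = l ^ 2) : l ∈ lenSet P Q := by
  set γ : ℝ → H := fun s => (x s, y s, t s) with hγ
  have hγc : ContDiff ℝ 1 γ := hx.prodMk (hy.prodMk ht)
  obtain ⟨K, hK⟩ := (hγc.contDiffOn (s := Set.Icc (0:ℝ) 1)).exists_lipschitzOnWith (by decide)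
    (convex_Icc _ _) isCompact_Icc
  have hs : ∀ s, Real.sqrt (a s ^ 2 + b s ^ 2) = l := fun s => by rw [hab, Real.sqrt_sq hl]
  have hcl : LipschitzWith 1 (fun s : ℝ => max 0 (min s 1)) :=
    (LipschitzWith.id.min_const 1).const_max 0
  refine ⟨fun s => γ (max 0 (min s 1)), a, b, K * 1, ?_, ?_, ?_, ?_, ?_, ?_⟩
  · rw [← lipschitzOnWith_univ] at hcl ⊢
    exact hK.comp hcl (fun s _ => ⟨le_max_left _ _, max_le zero_le_one (min_le_right _ _)⟩)
  · simpa [hγ] using h0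
  · simpa [hγ] using h1
  · have e0 : ∀ᵐ s : ℝ, s ≠ 0 := by simp [ae_iff, measure_singleton]
    have e1 : ∀ᵐ s : ℝ, s ≠ 1 := by simp [ae_iff, measure_singleton]
    filter_upwards [e0, e1] with s n0 n1 hs
    have p0 : 0 < s := lt_of_le_of_ne hs.1 n0.symm
    have p1 : s < 1 := lt_of_le_of_ne hs.2 n1
    have ee : max 0 (min s 1) = s := by rw [min_eq_left hs.2, max_eq_right hs.1]
    rw [ee]
    have hd : HasDerivAt γ (a s, b s, 2 * (γ s).2.1 * a s - 2 * (γ s).1 * b s) s :=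
      (dx s).prodMk ((dy s).prodMk (dt s))
    apply hd.congr_of_eventuallyEq
    filter_upwards [Ioo_mem_nhds p0 p1] with r hr
    rw [min_eq_left hr.2.le, max_eq_right hr.1.le]
  · simp only [hs]; exact intervalIntegrable_const
  · simp [hs]

lemma ext_of_rel {P Q : H} {x y t : ℝ} (h1 : Q.1 - P.1 = x - P.1) (h2 : Q.2.1 - P.2.1 = y - P.2.1)
    (h3 : rT P Q = t - P.2.2 + 2 * (P.1 * y - x * P.2.1)) : (x, y, t) = Q := by
  rw [rT_eq] at h3
  have e1 : Q.1 = x := by linarith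
  have e2 : Q.2.1 = y := by linarith
  rw [e1, e2] at h3
  have e3 : Q.2.2 = t := by linarith
  rw [← e1, ← e2, ← e3]

lemma arc_len {P Q : H} {p q θ ς : ℝ} (hθ : 0 ≤ θ) (hς : ς ^ 2 = 1)
    (h1 : Q.1 - P.1 = Real.sin θ * (p * Real.cos θ - ς * q * Real.sin θ))
    (h2 : Q.2.1 - P.2.1 = Real.sin θ * (q * Real.cos θ + ς * p * Real.sin θ))
    (h3 : rT P Q = - ς * (p ^ 2 + q ^ 2) * (θ - Real.sin θ * Real.cos θ)) :
    θ * Real.sqrt (p ^ 2 + q ^ 2) ∈ lenSet P Q := by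
  set x : ℝ → ℝ := fun s => P.1 + Real.sin (θ * s) * (p * Real.cos (θ * s) - ς * q * Real.sin (θ * s)) with hx
  set y : ℝ → ℝ := fun s => P.2.1 + Real.sin (θ * s) * (q * Real.cos (θ * s) + ς * p * Real.sin (θ * s)) with hy
  set t : ℝ → ℝ := fun s => P.2.2 - ς * (p ^ 2 + q ^ 2) * (θ * s - Real.sin (θ * s) * Real.cos (θ * s))
    - 2 * (P.1 * y s - x s * P.2.1) with ht
  have cs : ∀ s, Real.cos (θ * s) ^ 2 + Real.sin (θ * s) ^ 2 = 1 := fun s => by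
    rw [Real.cos_sq_add_sin_sq]
  have dl : ∀ s, HasDerivAt (fun s => θ * s) θ s := fun s => by
    simpa using (hasDerivAt_id s).const_mul θ
  have dx : ∀ s, HasDerivAt x (θ * (p * (Real.cos (θ * s) ^ 2 - Real.sin (θ * s) ^ 2)
      - 2 * ς * q * Real.sin (θ * s) * Real.cos (θ * s))) s := by
    intro s
    convert! (((dl s).sin).fun_mul ((((dl s).cos).const_mul p).fun_sub (((dl s).sin).const_mul (ς * q)))).const_add P.1 using 1
    ring
  have dy : ∀ s, HasDerivAt y (θ * (q * (Real.cos (θ * s) ^ 2 - Real.sin (θ * s) ^ 2)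
      + 2 * ς * p * Real.sin (θ * s) * Real.cos (θ * s))) s := by
    intro s
    convert! (((dl s).sin).fun_mul ((((dl s).cos).const_mul q).fun_add (((dl s).sin).const_mul (ς * p)))).const_add P.2.1 using 1
    ring
  refine smooth_len (x := x) (y := y) (t := t) (by fun_prop) (by fun_prop) (by fun_prop) dx dy ?_ ?_ ?_
    (by positivity) ?_
  · intro s
    convert! ((((dl s).fun_sub (((dl s).sin).fun_mul (dl s).cos)).const_mul (ς * (p ^ 2 + q ^ 2))).const_sub P.2.2).fun_sub
      ((((dy s).const_mul P.1).fun_sub ((dx s).mul_const P.2.1)).const_mul 2) using 1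
    simp only [hx, hy]
    have c2 : Real.cos (θ * s) ^ 2 = 1 - Real.sin (θ * s) ^ 2 := by linarith [cs s]
    ring_nf
    simp only [c2]
    ring
  · simp [hx, hy, ht]
    try ring
  · apply ext_of_rel
    · rw [h1]; simp [hx]
    · rw [h2]; simp [hy]
    · rw [h3]; simp [ht]; ring
  · intro s
    rw [mul_pow θ (Real.sqrt _), Real.sq_sqrt (by positivity)]
    have : ∀ C S : ℝ, C ^ 2 + S ^ 2 = 1 → (θ * (p * (C ^ 2 - S ^ 2)
      - 2 * ς * q * S * C)) ^ 2 + (θ * (q * (C ^ 2 - S ^ 2)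
      + 2 * ς * p * S * C)) ^ 2 = θ ^ 2 * (p ^ 2 + q ^ 2) := by
      intro C S h
      have : (θ * (p * (C ^ 2 - S ^ 2)
      - 2 * ς * q * S * C)) ^ 2 + (θ * (q * (C ^ 2 - S ^ 2)
      + 2 * ς * p * S * C)) ^ 2 = θ ^ 2 * (p ^ 2 + q ^ 2) * ((C ^ 2 - S ^ 2) ^ 2 + ς ^ 2 * 4 * S ^ 2 * C ^ 2) := by ring
      rw [this, hς]
      have e : C ^ 2 = 1 - S ^ 2 := by linarith
      rw [e]; ring
    exact this _ _ (cs s)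

lemma line_len {P Q : H} (hT : rT P Q = 0) : Real.sqrt (rA P Q) ∈ lenSet P Q := by
  rw [rT_eq] at hT
  set X := Q.1 - P.1 with hX
  set Y := Q.2.1 - P.2.1 with hY
  refine smooth_len (x := fun s => P.1 + s * X) (y := fun s => P.2.1 + s * Y)
    (t := fun s => P.2.2 + s * (2 * (P.2.1 * X - P.1 * Y)))
    (a := fun _ => X) (b := fun _ => Y) (by fun_prop) (by fun_prop) (by fun_prop) ?_ ?_ ?_ ?_ ?_
    (Real.sqrt_nonneg _) ?_
  · intro s; simpa using ((hasDerivAt_id s).mul_const X).const_add P.1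
  · intro s; simpa using ((hasDerivAt_id s).mul_const Y).const_add P.2.1
  · intro s
    convert! ((hasDerivAt_id s).mul_const (2 * (P.2.1 * X - P.1 * Y))).const_add P.2.2 using 1
    ring
  · simp
  · apply ext_of_rel
    · simp [hX]
    · simp [hY]
    · rw [rT_eq, hX, hY]; linear_combination hT
  · intro s
    rw [Real.sq_sqrt (by rw [rA_eq]; positivity), rA_eq]

lemma cot_lower {θ : ℝ} (h0 : 0 < θ) (h1 : θ ≤ 1) : 1 - θ ^ 2 / 2 ≤ θ * (Real.cos θ / Real.sin θ) := by
  have hs : 0 < Real.sin θ := Real.sin_pos_of_pos_of_lt_pi h0 (by linarith [Real.pi_gt_three])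
  rw [← mul_div_assoc, le_div_iff₀ hs]
  have h2 := Real.one_sub_sq_div_two_le_cos (x := θ)
  have h3 := Real.sin_le h0.le
  have h4 : 0 ≤ 1 - θ ^ 2 / 2 := by nlinarith
  calc (1 - θ ^ 2 / 2) * Real.sin θ ≤ (1 - θ ^ 2 / 2) * θ := by gcongr
    _ ≤ Real.cos θ * θ := by gcongr
    _ = _ := by ring

lemma cot_upper {θ : ℝ} (h0 : 0 < θ) (h1 : θ < Real.pi) : θ * (Real.cos θ / Real.sin θ) ≤ 1 := by
  have hs : 0 < Real.sin θ := Real.sin_pos_of_pos_of_lt_pi h0 h1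
  rw [← mul_div_assoc, div_le_one hs]
  rcases lt_or_ge θ (Real.pi / 2) with h | h
  · have hc : 0 < Real.cos θ := Real.cos_pos_of_mem_Ioo ⟨by linarith, h⟩
    have := Real.lt_tan h0 h
    rw [Real.tan_eq_sin_div_cos, lt_div_iff₀ hc] at this
    exact this.le
  · have : Real.cos θ ≤ 0 := Real.cos_nonpos_of_pi_div_two_le_of_le h (by linarith)
    nlinarith

lemma exists_angle {A T : ℝ} (hA : 0 < A) (hT : 0 < T) : ∃ θ, 0 < θ ∧ θ < Real.pi ∧
    T * Real.sin θ ^ 2 = A * (θ - Real.sin θ * Real.cos θ) := by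
  set h : ℝ → ℝ := fun θ => T * Real.sin θ ^ 2 - A * (θ - Real.sin θ * Real.cos θ) with hh
  set θ₀ := min 1 (T / (8 * A)) with hθ
  have p0 : 0 < θ₀ := by positivity
  have p1 : θ₀ ≤ 1 := min_le_left _ _
  have p2 : A * θ₀ ≤ T / 8 := by
    have : θ₀ ≤ T / (8 * A) := min_le_right _ _
    calc A * θ₀ ≤ A * (T / (8 * A)) := by gcongr
      _ = T / 8 := by field_simp
  have hpi := Real.pi_gt_three
  have hpi4 := Real.pi_le_four
  have s1 : θ₀ / 2 ≤ Real.sin θ₀ := by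
    have := Real.mul_le_sin p0.le (by linarith)
    refine le_trans ?_ this
    rw [div_mul_eq_mul_div, div_le_div_iff₀ (by norm_num) (by positivity)]
    nlinarith
  have s2 := Real.sin_gt_sub_cube (x := 2 * θ₀) (by positivity)
  rw [Real.sin_two_mul] at s2
  have h1 : 0 < h θ₀ := by
    simp only [hh]
    have e1 : T * (θ₀ / 2) ^ 2 ≤ T * Real.sin θ₀ ^ 2 := by gcongr
    have e2 : A * (θ₀ - Real.sin θ₀ * Real.cos θ₀) ≤ A * θ₀ ^ 3 := by
      apply mul_le_mul_of_nonneg_left _ hA.le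
      nlinarith [pow_pos p0 3]
    have e3 : A * θ₀ ^ 3 ≤ T / 8 * θ₀ ^ 2 := by
      calc A * θ₀ ^ 3 = A * θ₀ * θ₀ ^ 2 := by ring
        _ ≤ _ := by gcongr
    have : 0 < T * θ₀ ^ 2 := by positivity
    nlinarith
  have h2 : h Real.pi < 0 := by
    simp [hh]; positivity
  have hc : ContinuousOn h (Set.Icc θ₀ Real.pi) := by fun_prop
  obtain ⟨θ, hθm, hθe⟩ := intermediate_value_Icc' (by linarith) hc ⟨h2.le, h1.le⟩
  refine ⟨θ, by linarith [hθm.1], ?_, by simp only [hh] at hθe; linarith⟩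
  rcases lt_or_eq_of_le hθm.2 with h | h
  · exact h
  · rw [h] at hθe; linarith

lemma exists_arc (P Q : H) : ∃ l ∈ lenSet P Q, ∀ η > 0, ∃ θ ς : ℝ, 0 < θ ∧ θ < Real.pi ∧ ς ^ 2 = 1 ∧
    l ^ 2 ≤ θ * (Real.cos θ / Real.sin θ) * rA P Q + θ * ς * rT P Q + η := by
  have hpi := Real.pi_gt_three
  have hA0 : 0 ≤ rA P Q := by rw [rA_eq]; positivity
  by_cases hT : rT P Q = 0
  · refine ⟨_, line_len hT, fun η hη => ?_⟩
    rw [Real.sq_sqrt hA0, hT]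
    set θ := min 1 (η / (rA P Q + 1)) with hθ
    have p0 : 0 < θ := by positivity
    have p1 : θ ≤ 1 := min_le_left _ _
    refine ⟨θ, 1, p0, by linarith, by norm_num, ?_⟩
    have h1 := mul_le_mul_of_nonneg_right (cot_lower p0 p1) hA0
    have h2 : θ * (rA P Q + 1) ≤ η := by
      rw [← le_div_iff₀ (by positivity)]; exact min_le_right _ _
    have h3 : θ ^ 2 * rA P Q ≤ θ * rA P Q := by
      apply mul_le_mul_of_nonneg_right _ hA0; nlinarith
    nlinarith
  obtain ⟨σ, hσ, hσT⟩ : ∃ σ : ℝ, σ ^ 2 = 1 ∧ σ * rT P Q = |rT P Q| := by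
    rcases lt_or_gt_of_ne hT with h | h
    · exact ⟨-1, by norm_num, by rw [abs_of_neg h]; ring⟩
    · exact ⟨1, by norm_num, by rw [abs_of_pos h]; ring⟩
  have hTσ : rT P Q = σ * |rT P Q| := by rw [← hσT, ← mul_assoc, ← sq, hσ, one_mul]
  have hT0 : 0 < |rT P Q| := abs_pos.2 hT
  rcases hA0.eq_or_lt with hA | hA
  · have hA' := hA.symm
    rw [rA_eq] at hA'
    have e1 : Q.1 - P.1 = 0 := by nlinarith [sq_nonneg (Q.1 - P.1), sq_nonneg (Q.2.1 - P.2.1)]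
    have e2 : Q.2.1 - P.2.1 = 0 := by nlinarith [sq_nonneg (Q.1 - P.1), sq_nonneg (Q.2.1 - P.2.1)]
    have e3 : Real.sqrt (|rT P Q| / Real.pi) ^ 2 = |rT P Q| / Real.pi :=
      Real.sq_sqrt (by positivity)
    refine ⟨_, arc_len (P := P) (Q := Q) (p := Real.sqrt (|rT P Q| / Real.pi)) (q := 0)
      (θ := Real.pi) (ς := -σ) Real.pi_pos.le (by rw [neg_sq, hσ]) (by simp [e1]) (by simp [e2]) ?_, ?_⟩
    · refine hTσ.trans ?_
      rw [e3]; simp; field_simp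
    · intro η hη
      rw [mul_pow, Real.sq_sqrt (by positivity), e3, ← hA]
      set θ := max 1 (Real.pi - η / |rT P Q|) with hθ
      refine ⟨θ, σ, by positivity, ?_, hσ, ?_⟩
      · apply max_lt (by linarith); have : 0 < η / |rT P Q| := by positivity
        linarith
      · rw [mul_assoc θ σ, hσT]
        have : (Real.pi - η / |rT P Q|) * |rT P Q| ≤ θ * |rT P Q| := by gcongr; exact le_max_right _ _
        rw [sub_mul, div_mul_cancel₀ _ hT0.ne'] at this
        have e : Real.pi ^ 2 * (|rT P Q| / Real.pi + 0 ^ 2) = Real.pi * |rT P Q| := by field_simp; ring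
        rw [e]; linarith
  · obtain ⟨θ, p0, p1, he⟩ := exists_angle hA hT0
    have hs : 0 < Real.sin θ := Real.sin_pos_of_pos_of_lt_pi p0 p1
    have hcs : Real.cos θ ^ 2 + Real.sin θ ^ 2 = 1 := Real.cos_sq_add_sin_sq θ
    set S := Real.sin θ
    set C := Real.cos θ
    set X := Q.1 - P.1 with hX
    set Y := Q.2.1 - P.2.1 with hY
    have hAe : rA P Q = X ^ 2 + Y ^ 2 := rA_eq P Q
    have hpq : ((X * C - σ * Y * S) / S) ^ 2 + ((Y * C + σ * X * S) / S) ^ 2 = rA P Q / S ^ 2 := by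
      rw [div_pow, div_pow, ← add_div, hAe]
      congr 1
      calc _ = (X ^ 2 + Y ^ 2) * (C ^ 2 + σ ^ 2 * S ^ 2) := by ring
        _ = _ := by rw [hσ, one_mul, hcs, mul_one]
    refine ⟨_, arc_len (P := P) (Q := Q) (p := (X * C - σ * Y * S) / S)
      (q := (Y * C + σ * X * S) / S) (θ := θ) (ς := -σ) p0.le (by rw [neg_sq, hσ]) ?_ ?_ ?_, ?_⟩
    · change X = S * ((X * C - σ * Y * S) / S * C - -σ * ((Y * C + σ * X * S) / S) * S)
      field_simp
      linear_combination (-X) * hcs - X * S ^ 2 * hσ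
    · change Y = S * ((Y * C + σ * X * S) / S * C + -σ * ((X * C - σ * Y * S) / S) * S)
      field_simp
      linear_combination (-Y) * hcs - Y * S ^ 2 * hσ
    · refine hTσ.trans ?_
      rw [hpq]
      change _ = - -σ * (rA P Q / S ^ 2) * (θ - S * C)
      have : |rT P Q| = rA P Q / S ^ 2 * (θ - S * C) := by
        field_simp; linarith
      rw [this]; ring
    · intro η hη
      refine ⟨θ, σ, p0, p1, hσ, ?_⟩
      rw [mul_pow, Real.sq_sqrt (by positivity), hpq, mul_assoc θ σ, hσT]
      have : |rT P Q| = rA P Q / S ^ 2 * (θ - S * C) := by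
        field_simp; linarith
      rw [this]
      have : θ ^ 2 * (rA P Q / S ^ 2) = θ * (C / S) * rA P Q + θ * (rA P Q / S ^ 2 * (θ - S * C)) := by
        field_simp; ring
      linarith

lemma dH_nonneg (P Q : H) : 0 ≤ dH P Q := by
  rw [dH_eq]
  exact Real.sInf_nonneg fun x hx => lenSet_nonneg hx

lemma lower_dH (P Q : H) {θ ς : ℝ} (h0 : 0 < θ)
    (hπ : θ < Real.pi) (hς : ς ^ 2 = 1) :
    θ * (Real.cos θ / Real.sin θ) * rA P Q + θ * ς * rT P Q ≤ dH P Q ^ 2 := by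
  have hd := dH_nonneg P Q
  by_contra! h
  set G := θ * (Real.cos θ / Real.sin θ) * rA P Q + θ * ς * rT P Q
  have hr : dH P Q < Real.sqrt G := Real.lt_sqrt_of_sq_lt h
  have hG : Real.sqrt G ^ 2 = G := Real.sq_sqrt (by nlinarith)
  obtain ⟨Λ, hΛ1, hΛ2⟩ := exists_between hr
  obtain ⟨l, hl, -⟩ := exists_arc P Q
  have hd' := dH_eq P Q
  obtain ⟨L, hL, hLΛ⟩ := exists_lt_of_csInf_lt ⟨l, hl⟩ (hd' ▸ hΛ1)
  have h1 : G ≤ Λ ^ 2 := lower_len hL hLΛ h0 hπ hς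
  nlinarith

lemma upper_dH (P Q : H) {η : ℝ} (hη : 0 < η) : ∃ θ ς : ℝ, 0 < θ ∧ θ < Real.pi ∧ ς ^ 2 = 1 ∧
    dH P Q ^ 2 ≤ θ * (Real.cos θ / Real.sin θ) * rA P Q + θ * ς * rT P Q + η := by
  obtain ⟨l, hl, h⟩ := exists_arc P Q
  obtain ⟨θ, ς, h1, h2, h3, h4⟩ := h η hη
  refine ⟨θ, ς, h1, h2, h3, le_trans ?_ h4⟩
  exact pow_le_pow_left₀ (dH_nonneg _ _) (dH_le hl) 2

lemma half_ineq (P M Q : H) {φ ς : ℝ} (h0 : 0 < φ) (h1 : φ < Real.pi / 2) (hς : ς ^ 2 = 1) :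
    2 * φ * (Real.cos (2 * φ) / Real.sin (2 * φ)) * rA P Q + 2 * φ * ς * rT P Q ≤
    2 * (φ * (Real.cos φ / Real.sin φ) * rA P M + φ * ς * rT P M) +
    2 * (φ * (Real.cos φ / Real.sin φ) * rA M Q + φ * ς * rT M Q) := by
  have hS : 0 < Real.sin φ := Real.sin_pos_of_pos_of_lt_pi h0 (by linarith)
  have hC : 0 < Real.cos φ := Real.cos_pos_of_mem_Ioo ⟨by linarith, h1⟩
  rw [Real.cos_two_mul', Real.sin_two_mul]
  set S := Real.sin φ
  set C := Real.cos φ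
  simp only [rA_eq, rT_eq]
  obtain ⟨x1, hx1⟩ : ∃ x1, x1 = M.1 - P.1 := ⟨_, rfl⟩
  obtain ⟨y1, hy1⟩ : ∃ y1, y1 = M.2.1 - P.2.1 := ⟨_, rfl⟩
  obtain ⟨x2, hx2⟩ : ∃ x2, x2 = Q.1 - M.1 := ⟨_, rfl⟩
  obtain ⟨y2, hy2⟩ : ∃ y2, y2 = Q.2.1 - M.2.1 := ⟨_, rfl⟩
  have key : 0 ≤ φ / (S * C) * ((C * (x1 - x2) + ς * S * (y1 + y2)) ^ 2 +
    (C * (y1 - y2) - ς * S * (x1 + x2)) ^ 2) := by positivity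
  have key2 : φ / (S * C) * ((C * (x1 - x2) + ς * S * (y1 + y2)) ^ 2 +
    (C * (y1 - y2) - ς * S * (x1 + x2)) ^ 2) = 2 * φ * (C / S) * (x1 ^ 2 + y1 ^ 2 + x2 ^ 2 + y2 ^ 2)
      - 2 * φ * ((C ^ 2 - S ^ 2) / (2 * S * C)) * ((x1 + x2) ^ 2 + (y1 + y2) ^ 2)
      - 2 * φ * ς * (2 * (x2 * y1 - x1 * y2)) := by
    field_simp
    linear_combination (S ^ 2 * ((x1 + x2) ^ 2 + (y1 + y2) ^ 2)) * hς
  rw [key2] at key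
  subst hx1 hy1 hx2 hy2
  refine le_of_sub_nonneg (key.trans (le_of_eq ?_))
  ring

lemma halving {ε : ℝ} {γ : ℝ → H} (h0 : 0 ≤ ε) (h1 : ε ≤ 1 / 10) (hγ : IsQuasiGeodesic ε γ) (k : ℕ) :
    ∀ s h η : ℝ, 0 < η → ∃ θ ς : ℝ, 0 < θ ∧ θ < Real.pi / 2 ^ k ∧ ς ^ 2 = 1 ∧
    dH (γ s) (γ (s + h)) ^ 2 ≤ θ * (Real.cos θ / Real.sin θ) * rA (γ s) (γ (s + h)) +
      θ * ς * rT (γ s) (γ (s + h)) + 10 * ε * (2 ^ k - 1) * h ^ 2 + η := by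
  induction k with
  | zero =>
    intro s h η hη
    obtain ⟨θ, ς, h1, h2, h3, h4⟩ := upper_dH (γ s) (γ (s + h)) hη
    exact ⟨θ, ς, h1, by simpa using h2, h3, by simpa using h4⟩
  | succ k ih =>
    intro s h η hη
    obtain ⟨θ, ς, i1, i2, i3, i4⟩ := ih s (2 * h) η hη
    have hk : (1:ℝ) ≤ 2 ^ k := one_le_pow₀ (by norm_num)
    have hθπ : θ < Real.pi := i2.trans_le (div_le_self Real.pi_pos.le hk)
    obtain ⟨φ, rfl⟩ : ∃ φ, θ = 2 * φ := ⟨θ / 2, by ring⟩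
    have hφ0 : 0 < φ := by linarith
    refine ⟨φ, ς, hφ0, ?_, i3, ?_⟩
    · rw [pow_succ, ← div_div]; linarith
    · have a1 := half_ineq (γ s) (γ (s + h)) (γ (s + 2 * h)) hφ0 (by linarith) i3
      have a2 := lower_dH (γ (s + h)) (γ (s + 2 * h)) hφ0 (by linarith) i3
      have b1 := (hγ s (s + h)).2
      have b2 := (hγ (s + h) (s + 2 * h)).2
      have b3 := (hγ s (s + 2 * h)).1
      rw [show s - (s + h) = -h by ring, abs_neg] at b1
      rw [show s + h - (s + 2 * h) = -h by ring, abs_neg] at b2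
      rw [show s - (s + 2 * h) = -(2 * h) by ring, abs_neg, abs_mul, abs_two] at b3
      have c1 := pow_le_pow_left₀ (dH_nonneg _ _) b1 2
      have c2 := pow_le_pow_left₀ (dH_nonneg _ _) b2 2
      have c3 := pow_le_pow_left₀ (by positivity) b3 2
      simp only [mul_pow, sq_abs] at c1 c2 c3
      have e1 : (1 + ε) ^ 2 ≤ 1 + 21 / 10 * ε := by nlinarith
      have e2 : 1 - 2 * ε ≤ ((1 + ε)⁻¹) ^ 2 := by
        rw [inv_pow, ← one_div, le_div_iff₀ (by positivity)]
        nlinarith [mul_nonneg h0 (sq_nonneg ε)]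
      have hh := sq_nonneg h
      have d1 := mul_le_mul_of_nonneg_right e1 hh
      have d2 := mul_le_mul_of_nonneg_right e2 hh
      have d3 := mul_nonneg h0 hh
      rw [pow_succ (2:ℝ) k]
      nlinarith

lemma quasi_mono {ε ε' : ℝ} {γ : ℝ → H} (h0 : 0 ≤ ε) (h : ε ≤ ε') (hγ : IsQuasiGeodesic ε γ) :
    IsQuasiGeodesic ε' γ := by
  intro s s'
  obtain ⟨h1, h2⟩ := hγ s s'
  constructor
  · refine le_trans ?_ h1
    gcongr
  · refine h2.trans ?_
    gcongr

set_option maxHeartbeats 2000000 in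
lemma main_pos {ε : ℝ} {γ : ℝ → H} (h0 : 0 < ε) (h1 : ε < 1 / 2500) (hγ : IsQuasiGeodesic ε γ)
    (s₀ s : ℝ) : |rT (γ s₀) (γ s)| ≤ 60 * ε ^ ((1:ℝ)/4) * rA (γ s₀) (γ s) := by
  by_cases hh : s = s₀
  · subst hh
    simp [rT_eq, rA_eq]
    try exact le_of_eq (by ring)
  obtain ⟨h, rfl⟩ : ∃ h, s = s₀ + h := ⟨s - s₀, by ring⟩
  have hne : h ≠ 0 := by simpa using hh
  have hℓ : 0 < h ^ 2 := by positivity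
  have hpi := Real.pi_gt_three
  have hpi4 := Real.pi_lt_d2
  set ψ := ε ^ ((1:ℝ)/4) with hψ
  have hψ0 : 0 < ψ := by positivity
  have hψ4 : ψ ^ 4 = ε := by
    rw [hψ, ← Real.rpow_natCast, ← Real.rpow_mul h0.le]; norm_num
  obtain ⟨δ, hδ⟩ : ∃ δ, δ = ψ ^ 2 := ⟨_, rfl⟩
  have hδ0 : 0 < δ := by rw [hδ]; positivity
  have hδε : ε = δ ^ 2 := by rw [hδ, ← hψ4]; ring
  have hδ1 : δ < 1 / 50 := by
    by_contra! hc
    nlinarith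
  have hψ1 : ψ ≤ 1 := by
    by_contra! hc
    nlinarith
  obtain ⟨k, hk1, hk2⟩ := exists_nat_pow_near (x := 1 / δ) (y := 2) (by
    rw [le_div_iff₀ hδ0]; linarith) (by norm_num)
  rw [le_div_iff₀ hδ0] at hk1
  rw [div_lt_iff₀ hδ0, pow_succ] at hk2
  obtain ⟨θ, ς, t0, t1, t2, t3⟩ := halving h0.le (by linarith) hγ k s₀ h (δ * h ^ 2) (by positivity)
  have hk : (1:ℝ) ≤ 2 ^ k := one_le_pow₀ (by norm_num)
  have hθπ : θ < Real.pi := t1.trans_le (div_le_self Real.pi_pos.le hk)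
  have hθδ : θ ≤ 7 * δ := by
    rw [lt_div_iff₀ (by positivity)] at t1
    have : θ ≤ θ * (2 ^ k * 2 * δ) := by nlinarith
    nlinarith
  have cu := cot_upper t0 hθπ
  set A := rA (γ s₀) (γ (s₀ + h)) with hA
  set T := rT (γ s₀) (γ (s₀ + h)) with hT
  set D := dH (γ s₀) (γ (s₀ + h)) with hD
  have hA0 : 0 ≤ A := by rw [hA, rA_eq]; positivity
  obtain ⟨σ, hσ, hσT⟩ : ∃ σ : ℝ, σ ^ 2 = 1 ∧ σ * T = |T| := by
    rcases le_total T 0 with h | h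
    · exact ⟨-1, by norm_num, by rw [abs_of_nonpos h]; ring⟩
    · exact ⟨1, by norm_num, by rw [abs_of_nonneg h]; ring⟩
  have hςT : ς * T ≤ |T| := by
    refine (le_abs_self _).trans ?_
    rw [abs_mul]
    have : |ς| = 1 := by rw [← Real.sqrt_sq_eq_abs, t2, Real.sqrt_one]
    rw [this, one_mul]
  have b1 := (hγ s₀ (s₀ + h)).1
  have b2 := (hγ s₀ (s₀ + h)).2
  rw [show s₀ - (s₀ + h) = -h by ring, abs_neg] at b1 b2
  have c1 := pow_le_pow_left₀ (by positivity) b1 2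
  have c2 := pow_le_pow_left₀ (dH_nonneg _ _) b2 2
  simp only [mul_pow, sq_abs] at c1 c2
  have e1 : (1 + ε) ^ 2 ≤ 1 + 21 / 10 * ε := by nlinarith
  have e2 : 1 - 2 * ε ≤ ((1 + ε)⁻¹) ^ 2 := by
    rw [inv_pow, ← one_div, le_div_iff₀ (by positivity)]
    nlinarith [mul_nonneg h0.le (sq_nonneg ε)]
  have hεδ : ε ≤ δ / 50 := by rw [hδε]; nlinarith
  have d1 : D ^ 2 ≤ (1 + δ / 10) * h ^ 2 := by
    refine c2.trans ?_
    gcongr; linarith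
  have d2 : (1 - δ / 10) * h ^ 2 ≤ D ^ 2 := by
    refine le_trans ?_ c1
    gcongr; linarith
  -- crude bound on T
  have f1 : |T| ≤ D ^ 2 := by
    have := lower_dH (γ s₀) (γ (s₀ + h)) (θ := Real.pi / 2) (half_pos Real.pi_pos) (half_lt_self Real.pi_pos) hσ
    rw [Real.cos_pi_div_two] at this
    rw [mul_assoc _ σ, hσT] at this
    simp at this
    nlinarith [abs_nonneg T]
  have f5 := lower_dH (γ s₀) (γ (s₀ + h)) hψ0 (by linarith) hσ
  rw [mul_assoc ψ σ, hσT] at f5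
  rw [← hA, ← hD] at f5
  have f6 := mul_le_mul_of_nonneg_right (cot_lower hψ0 hψ1) hA0
  rw [← hδ] at f6
  clear_value A T D ψ
  generalize θ * (Real.cos θ / Real.sin θ) = cθ at *
  generalize ψ * (Real.cos ψ / Real.sin ψ) = cψ at *
  generalize (2:ℝ) ^ k = kk at *
  clear b1 b2 c1 c2 e1 e2 hψ hA hT hD
  have f2 : D ^ 2 ≤ A + 20 * δ * h ^ 2 := by
    have g1 : cθ * A ≤ A := mul_le_of_le_one_left hA0 cu
    have g2 : θ * ς * T ≤ 7 * δ * |T| := by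
      rw [mul_assoc]
      calc θ * (ς * T) ≤ θ * |T| := by gcongr
        _ ≤ _ := by gcongr
    have g3 : 7 * δ * |T| ≤ 7 * δ * ((1 + δ / 10) * h ^ 2) := by
      gcongr; exact f1.trans d1
    have g4 : 7 * δ * ((1 + δ / 10) * h ^ 2) ≤ 8 * δ * h ^ 2 := by
      have : 0 < δ * h ^ 2 := by positivity
      nlinarith
    have g5 : 10 * ε * (kk - 1) * h ^ 2 ≤ 10 * δ * h ^ 2 := by
      have : ε * (kk - 1) ≤ δ := by
        have q1 := mul_le_mul_of_nonneg_left hk1 hδ0.le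
        rw [hδε]; linarith [sq_nonneg δ]
      have q2 := mul_le_mul_of_nonneg_right this hℓ.le
      linarith
    have : 0 < δ * h ^ 2 := by positivity
    linarith
  have f3 : (1 - 21 * δ) * h ^ 2 ≤ A := by
    have : 0 < δ * h ^ 2 := by positivity
    linarith
  have f4 : h ^ 2 ≤ 2 * A := by nlinarith
  have f7 : ψ * |T| ≤ 30 * δ * h ^ 2 := by
    have : (1 - δ / 2) * ((1 - 21 * δ) * h ^ 2) ≤ (1 - δ / 2) * A := by
      gcongr; linarith
    have : 0 < δ * h ^ 2 := by positivity
    have : 0 < δ * (δ * h ^ 2) := by positivity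
    nlinarith
  have f8 : |T| ≤ 30 * ψ * h ^ 2 := by
    rw [hδ] at f7
    refine le_of_mul_le_mul_left (f7.trans (le_of_eq ?_)) hψ0
    ring
  calc |T| ≤ 30 * ψ * h ^ 2 := f8
    _ ≤ 30 * ψ * (2 * A) := by gcongr
    _ = _ := by ring

/-- Corollary: quasigeodesics avoid a cone at every point.
There are `ε₀ > 0`, `C > 0` such that for every `(1+ε)`-quasigeodesic `γ` with
`ε < ε₀` and all `s₀, s ∈ ℝ`, writing `γ(s₀)⁻¹·γ(s) = (z;t)`, one has
`|t| ≤ C ε^{1/4} |z|²`. -/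
theorem statement2 :
    ∃ ε₀ > (0:ℝ), ∃ C > (0:ℝ),
      ∀ ε : ℝ, 0 ≤ ε → ε < ε₀ →
      ∀ γ : ℝ → H, IsQuasiGeodesic ε γ →
      ∀ s₀ s : ℝ,
        |(Hmul (Hinv (γ s₀)) (γ s)).2.2| ≤
          C * ε ^ ((1:ℝ)/4) *
            ((Hmul (Hinv (γ s₀)) (γ s)).1 ^ 2 + (Hmul (Hinv (γ s₀)) (γ s)).2.1 ^ 2) := by
  refine ⟨1 / 2500, by norm_num, 60, by norm_num, ?_⟩
  intro ε h0 h1 γ hγ s₀ s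
  change |rT (γ s₀) (γ s)| ≤ 60 * ε ^ ((1:ℝ)/4) * rA (γ s₀) (γ s)
  rcases h0.eq_or_lt with h | h
  · have hc : Filter.Tendsto (fun e : ℝ => 60 * e ^ ((1:ℝ)/4) * rA (γ s₀) (γ s)) (nhdsWithin ε (Set.Ioi ε))
        (nhds (60 * ε ^ ((1:ℝ)/4) * rA (γ s₀) (γ s))) := by
      have : Continuous (fun e : ℝ => 60 * e ^ ((1:ℝ)/4) * rA (γ s₀) (γ s)) :=
        ((Real.continuous_rpow_const (by norm_num)).const_mul 60).mul_const _
      exact this.continuousAt.tendsto.mono_left nhdsWithin_le_nhds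
    refine ge_of_tendsto hc ?_
    filter_upwards [Ioo_mem_nhdsGT h1] with e he
    exact main_pos (h0.trans_lt he.1) he.2 (quasi_mono h0 he.1.le hγ) s₀ s
  · exact main_pos h h1 hγ s₀ s
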